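/- There exists a FROG in which two distinguished agents, Pursuer (agent 1) and Evader (agent 2), each have exactly two strategies, labelled 'up' and 'down', while every other agent has a unique strategy, and whose total delays satisfy: whenever Pursuer and Evader choose the same label, C_Pursuer = 12 and C_Evader = 13, and whenever they choose different labels, C_Pursuer = 13 and C_Evader = 12. Since in every one of the four resulting profiles exactly one of the two agents strictly improves by switching, this game has no pure Nash equilibrium. -/

import Mathlib

/-!  A formal model of First-in-first-out Routing Games (FROGs).

A FROG is a finite digraph whose edges carry a capacity `c e ≥ 1` and a fixed
delay `d e ≥ 0`, together with `n` agents, each having a source, a sink, a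
starting time, and a tie-breaking priority (`prio i < prio j` means `i ≻ j`).
Strategies are simple directed paths from source to sink.  The FIFO dynamics
are axiomatized by the predicate `IsFIFO` on executions (join/enter times for
every agent and every edge of its path). -/

structure FROG where
  nV : ℕ
  E : Finset (Fin nV × Fin nV)
  c : Fin nV × Fin nV → ℕ
  d : Fin nV × Fin nV → ℕ
  n : ℕ
  src : Fin n → Fin nV
  sink : Fin n → Fin nV
  start : Fin n → ℕ
  prio : Fin n → ℕ
  prio_inj : Function.Injective prio
  c_pos : ∀ e ∈ E, 1 ≤ c e

namespace FROG

/-- The type of (potential) edges of the digraph of `Γ`. -/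
abbrev Edge (Γ : FROG) := Fin Γ.nV × Fin Γ.nV

/-- `IsPathFrom Γ u v p`: the list of edges `p` is a directed path from `u` to `v`
in the digraph of `Γ`. -/
def IsPathFrom (Γ : FROG) : Fin Γ.nV → Fin Γ.nV → List Γ.Edge → Prop
  | u, v, [] => u = v
  | u, v, e :: p => e.1 = u ∧ e ∈ Γ.E ∧ Γ.IsPathFrom e.2 v p

/-- A path starting at `u` is simple if it visits no vertex twice. -/
def IsSimple (Γ : FROG) (u : Fin Γ.nV) (p : List Γ.Edge) : Prop :=
  (u :: p.map Prod.snd).Nodup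

/-- The strategy set of agent `i`: simple directed paths from its source to its sink. -/
def Strat (Γ : FROG) (i : Fin Γ.n) :=
  {p : List Γ.Edge // Γ.IsPathFrom (Γ.src i) (Γ.sink i) p ∧ Γ.IsSimple (Γ.src i) p}

/-- A strategy profile: one simple source-sink path per agent. -/
abbrev Profile (Γ : FROG) := ∀ i : Fin Γ.n, Γ.Strat i

/-- An agent is degenerate when it has a unique strategy. -/
def Degenerate (Γ : FROG) (j : Fin Γ.n) : Prop := ∀ s s' : Γ.Strat j, s = s'

variable {Γ : FROG}

/-- The `k`-th edge of the path of agent `i` in profile `π`. -/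
def edgeAt (π : Γ.Profile) (i : Fin Γ.n) (k : Fin (π i).val.length) : Γ.Edge :=
  (π i).val.get k

/-- An execution records, for each agent `i` and each edge of its path, the time
at which `i` joins the FIFO queue of that edge and the time at which it leaves
the queue and enters the edge. -/
structure Execution (π : Γ.Profile) where
  join : ∀ i : Fin Γ.n, Fin (π i).val.length → ℕ
  enter : ∀ i : Fin Γ.n, Fin (π i).val.length → ℕ

/-- `Ahead π ex j l i k`: in execution `ex`, agent `j` (at the `l`-th edge of its
path) is queued ahead of agent `i` (at the `k`-th edge of its path) on the same
edge: it joined strictly earlier, or at the same time step with higher priority. -/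
def Ahead (π : Γ.Profile) (ex : Execution π) (j : Fin Γ.n) (l : Fin (π j).val.length)
    (i : Fin Γ.n) (k : Fin (π i).val.length) : Prop :=
  edgeAt π j l = edgeAt π i k ∧ (j ≠ i ∨ l.val ≠ k.val) ∧
    (ex.join j l < ex.join i k ∨ (ex.join j l = ex.join i k ∧ Γ.prio j < Γ.prio i))

/-- The FIFO dynamics: agents start on the first edge of their path at their
starting time; queue joining times are enter time plus fixed delay of the
previous edge; the queue discipline never lets an agent overtake an agent ahead
of it; at each time step at most `c e` agents enter `e`; and service is eager:
an agent still waiting at time `t` does so only because `c e` agents ahead of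
it enter the edge at time `t`. -/
structure IsFIFO (π : Γ.Profile) (ex : Execution π) : Prop where
  join_start : ∀ i (h : 0 < (π i).val.length), ex.join i ⟨0, h⟩ = Γ.start i
  join_le_enter : ∀ i k, ex.join i k ≤ ex.enter i k
  transit : ∀ i (k : Fin (π i).val.length) (h : k.val + 1 < (π i).val.length),
    ex.join i ⟨k.val + 1, h⟩ = ex.enter i k + Γ.d (edgeAt π i k)
  no_overtake : ∀ j l i k, Ahead π ex j l i k → ex.enter j l ≤ ex.enter i k
  capacity : ∀ (e : Γ.Edge) (t : ℕ),
    Nat.card {p : Σ i : Fin Γ.n, Fin (π i).val.length //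
      edgeAt π p.1 p.2 = e ∧ ex.enter p.1 p.2 = t} ≤ Γ.c e
  eager : ∀ i k (t : ℕ), ex.join i k ≤ t → t < ex.enter i k →
    Γ.c (edgeAt π i k) ≤ Nat.card {p : Σ j : Fin Γ.n, Fin (π j).val.length //
      Ahead π ex p.1 p.2 i k ∧ ex.enter p.1 p.2 = t}

/-- Waiting time of agent `i` in the queue of the `k`-th edge of its path. -/
def waitTime (π : Γ.Profile) (ex : Execution π) (i : Fin Γ.n)
    (k : Fin (π i).val.length) : ℕ :=
  ex.enter i k - ex.join i k

/-- Total delay of agent `i`: sum over the edges of its path of the waiting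
time in the queue plus the fixed delay. -/
def cost (π : Γ.Profile) (ex : Execution π) (i : Fin Γ.n) : ℕ :=
  ∑ k : Fin (π i).val.length, (waitTime π ex i k + Γ.d (edgeAt π i k))

/-- The total delay `C_i(π)` of agent `i` under profile `π` (via the FIFO execution). -/
noncomputable def delay (π : Γ.Profile) (i : Fin Γ.n) : ℕ :=
  sInf {t | ∃ ex : Execution π, IsFIFO π ex ∧ cost π ex i = t}

/-- Pure Nash equilibrium: no agent can strictly decrease its total delay by a
unilateral deviation to another simple source-sink path. -/
def IsPNE (π : Γ.Profile) : Prop :=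
  ∀ (i : Fin Γ.n) (p' : Γ.Strat i), delay π i ≤ delay (Function.update π i p') i

end FROG

namespace FROG

/-- With positive fixed delays, agreement of two FIFO executions on all entries before time `t`
determines the queues up to time `t`. -/
theorem join_eq_of_agree {Γ : FROG} {π : Γ.Profile} (hd : ∀ e, 1 ≤ Γ.d e) {ex ex' : Execution π}
    (h : IsFIFO π ex) (h' : IsFIFO π ex') {t : ℕ}
    (agree : ∀ i k, ex.enter i k < t → ex'.enter i k = ex.enter i k)
    {i : Fin Γ.n} {k : Fin (π i).val.length} (hk : ex.join i k ≤ t) :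
    ex'.join i k = ex.join i k := by
  obtain ⟨k, hlt⟩ := k
  cases k with
  | zero => rw [h.join_start, h'.join_start]
  | succ k =>
    have e : ex.join i ⟨k + 1, hlt⟩ = _ := h.transit i ⟨k, by omega⟩ hlt
    have e' : ex'.join i ⟨k + 1, hlt⟩ = _ := h'.transit i ⟨k, by omega⟩ hlt
    have := hd (edgeAt π i ⟨k, by omega⟩)
    have := agree i ⟨k, by omega⟩ (by omega)
    omega

/-- If two FIFO executions agree before time `t`, then an entry at time `t` in one of them does
not happen later in the other one. -/
theorem enter_le_of_agree {Γ : FROG} {π : Γ.Profile} (hd : ∀ e, 1 ≤ Γ.d e) {ex ex' : Execution π}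
    (h : IsFIFO π ex) (h' : IsFIFO π ex') {t : ℕ}
    (agree : ∀ i k, ex.enter i k < t → ex'.enter i k = ex.enter i k)
    (agree' : ∀ i k, ex'.enter i k < t → ex.enter i k = ex'.enter i k)
    {i : Fin Γ.n} {k : Fin (π i).val.length} (hk : ex.enter i k = t) :
    ex'.enter i k ≤ t := by
  classical
  by_contra! hlt
  have hjt : ex.join i k ≤ t := hk ▸ h.join_le_enter i k
  have hj := join_eq_of_agree hd h h' agree hjt
  have card_ahead := h'.eager i k t (by omega) hlt
  have card_enter := h.capacity (edgeAt π i k) t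
  rw [Nat.card_eq_fintype_card, Fintype.card_subtype] at card_ahead card_enter
  refine absurd (card_ahead.trans_lt (Finset.card_lt_card ?_)) card_enter.not_gt
  rw [Finset.ssubset_iff_of_subset]
  · refine ⟨⟨i, k⟩, by simp [hk], fun hp => ?_⟩
    exact (Finset.mem_filter.1 hp).2.1.2.1.elim (· rfl) (· rfl)
  · rintro ⟨j, l⟩ hp
    simp only [Finset.mem_filter, Finset.mem_univ, true_and] at hp ⊢
    obtain ⟨⟨hedge, hne, hahead⟩, hl⟩ := hp
    have hjl : ex.join j l = ex'.join j l :=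
      join_eq_of_agree hd h' h agree' (by omega)
    have hle := h.no_overtake j l i k ⟨hedge, hne, by rw [hjl, ← hj]; exact hahead⟩
    refine ⟨hedge, (hk ▸ hle).antisymm ?_⟩
    by_contra! hlt'
    have := agree j l hlt'
    omega

/-- With positive fixed delays, FIFO executions are unique. -/
theorem IsFIFO.unique {Γ : FROG} {π : Γ.Profile} (hd : ∀ e, 1 ≤ Γ.d e) {ex ex' : Execution π}
    (h : IsFIFO π ex) (h' : IsFIFO π ex') : ex = ex' := by
  have key : ∀ t, ∀ i k, ex.enter i k = t ↔ ex'.enter i k = t := by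
    intro t
    induction t using Nat.strong_induction_on with
    | _ t ih =>
      have agree : ∀ i k, ex.enter i k < t → ex'.enter i k = ex.enter i k :=
        fun i k hlt => (ih _ hlt i k).1 rfl
      have agree' : ∀ i k, ex'.enter i k < t → ex.enter i k = ex'.enter i k :=
        fun i k hlt => (ih _ hlt i k).2 rfl
      intro i k
      constructor
      · intro hk
        have := enter_le_of_agree hd h h' agree agree' hk
        by_contra hne
        have := agree' i k (by omega)
        omega
      · intro hk
        have := enter_le_of_agree hd h' h agree' agree hk
        by_contra hne
        have := agree i k (by omega)
        omega
  have henter : ∀ i k, ex'.enter i k = ex.enter i k := fun i k => (key _ i k).1 rfl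
  have hjoin : ∀ i k, ex'.join i k = ex.join i k := fun i k =>
    join_eq_of_agree hd h h' (fun i k _ => henter i k) le_rfl
  cases ex
  cases ex'
  simp only [Execution.mk.injEq]
  exact ⟨funext fun i => funext fun k => (hjoin i k).symm,
    funext fun i => funext fun k => (henter i k).symm⟩

theorem IsFIFO.delay_eq {Γ : FROG} {π : Γ.Profile} (hd : ∀ e, 1 ≤ Γ.d e) {ex : Execution π}
    (h : IsFIFO π ex) (i : Fin Γ.n) : delay π i = cost π ex i := by
  have : {t | ∃ ex : Execution π, IsFIFO π ex ∧ cost π ex i = t} = {cost π ex i} := by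
    ext t
    constructor
    · rintro ⟨ex', h', rfl⟩
      rw [h'.unique hd h, Set.mem_singleton_iff]
    · rintro rfl
      exact ⟨ex, h, rfl⟩
  rw [delay, this, csInf_singleton]

instance decidableAhead {Γ : FROG} (π : Γ.Profile) (ex : Execution π) (j : Fin Γ.n)
    (l : Fin (π j).val.length) (i : Fin Γ.n) (k : Fin (π i).val.length) :
    Decidable (Ahead π ex j l i k) :=
  inferInstanceAs (Decidable (_ ∧ _ ∧ _))

/-- A criterion for the FIFO dynamics in which all quantifiers are bounded. -/
theorem IsFIFO.of_bounded {Γ : FROG} {π : Γ.Profile} {ex : Execution π}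
    (join_start : ∀ i (h : 0 < (π i).val.length), ex.join i ⟨0, h⟩ = Γ.start i)
    (join_le_enter : ∀ i k, ex.join i k ≤ ex.enter i k)
    (transit : ∀ i (k : Fin (π i).val.length) (h : k.val + 1 < (π i).val.length),
      ex.join i ⟨k.val + 1, h⟩ = ex.enter i k + Γ.d (edgeAt π i k))
    (no_overtake : ∀ j l i k, Ahead π ex j l i k → ex.enter j l ≤ ex.enter i k)
    (capacity : ∀ i k, (Finset.univ.filter fun p : Σ i : Fin Γ.n, Fin (π i).val.length =>
      edgeAt π p.1 p.2 = edgeAt π i k ∧ ex.enter p.1 p.2 = ex.enter i k).card ≤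
        Γ.c (edgeAt π i k))
    (eager : ∀ i k, ∀ t < ex.enter i k, ex.join i k ≤ t →
      Γ.c (edgeAt π i k) ≤ (Finset.univ.filter fun p : Σ i : Fin Γ.n, Fin (π i).val.length =>
        Ahead π ex p.1 p.2 i k ∧ ex.enter p.1 p.2 = t).card) :
    IsFIFO π ex where
  join_start := join_start
  join_le_enter := join_le_enter
  transit := transit
  no_overtake := no_overtake
  capacity e t := by
    by_cases hp : ∃ i k, edgeAt π i k = e ∧ ex.enter i k = t
    · obtain ⟨i, k, rfl, rfl⟩ := hp
      rw [Nat.card_eq_fintype_card, Fintype.card_subtype]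
      exact capacity i k
    · have : IsEmpty {p : Σ i : Fin Γ.n, Fin (π i).val.length //
          edgeAt π p.1 p.2 = e ∧ ex.enter p.1 p.2 = t} :=
        ⟨fun p => hp ⟨p.1.1, p.1.2, p.2⟩⟩
      simp
  eager i k t hj ht := by
    rw [Nat.card_eq_fintype_card, Fintype.card_subtype]
    exact eager i k t ht hj

instance decidableIsPathFrom (Γ : FROG) :
    ∀ (u v : Fin Γ.nV) (p : List Γ.Edge), Decidable (Γ.IsPathFrom u v p)
  | u, v, [] => inferInstanceAs (Decidable (u = v))
  | u, v, e :: p =>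
    have := decidableIsPathFrom Γ e.2 v p
    inferInstanceAs (Decidable (e.1 = u ∧ e ∈ Γ.E ∧ Γ.IsPathFrom e.2 v p))

instance decidableIsSimple (Γ : FROG) (u : Fin Γ.nV) (p : List Γ.Edge) :
    Decidable (Γ.IsSimple u p) :=
  inferInstanceAs (Decidable (List.Nodup _))

/-- All directed paths from `u` to `v` with at most `m` edges. -/
def paths (Γ : FROG) : ℕ → Fin Γ.nV → Fin Γ.nV → List (List Γ.Edge)
  | 0, u, v => if u = v then [[]] else []
  | m + 1, u, v => (if u = v then [[]] else []) ++
      (List.finRange Γ.nV).flatMap fun w =>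
        if (u, w) ∈ Γ.E then (paths Γ m w v).map ((u, w) :: ·) else []

theorem IsPathFrom.mem_paths {Γ : FROG} {m : ℕ} {u v : Fin Γ.nV} {p : List Γ.Edge}
    (hp : Γ.IsPathFrom u v p) (hm : p.length ≤ m) : p ∈ Γ.paths m u v := by
  induction p generalizing m u with
  | nil =>
    have : u = v := hp
    cases m <;> simp [paths, this]
  | cons e p ih =>
    obtain ⟨rfl, he, hp⟩ := hp
    cases m with
    | zero => simp at hm
    | succ m =>
      refine List.mem_append_right _ (List.mem_flatMap.2 ⟨e.2, List.mem_finRange _, ?_⟩)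
      rw [if_pos he]
      exact List.mem_map_of_mem (ih hp (by simpa using hm))

/-- Every strategy occurs in the list of paths of length at most the number of vertices. -/
theorem Strat.mem_paths {Γ : FROG} {i : Fin Γ.n} (s : Γ.Strat i) :
    s.val ∈ Γ.paths Γ.nV (Γ.src i) (Γ.sink i) := by
  refine s.2.1.mem_paths ?_
  have := s.2.2.length_le_card
  simp at this
  omega

end FROG

namespace PursuerEvader

open FROG

/-- The game.  Vertices: `0` and `1` are the sources of Pursuer (agent `0`) and Evader
(agent `1`), `2` is their sink, and `3, 4, 5` (`6, 7, 8`) form the upper (lower) branch.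
On the edge `(3, 4)`, a blocker (agent `4`) makes Evader queue; Evader in turn holds up a runner
(agent `2`), who otherwise beats Pursuer on the edge `(4, 2)`.  There Pursuer beats Evader.
Agents `3` and `5` play the same roles on the lower branch. -/
abbrev game : FROG where
  nV := 9
  E := {(0, 4), (0, 7), (1, 3), (1, 6), (5, 3), (8, 6), (3, 4), (6, 7), (4, 2), (7, 2)}
  c e := if e.1 = 1 then 2 else 1
  d e := ![3, 1, 1, 1, 9, 2, 1, 9, 2] e.1
  n := 6
  src := ![0, 1, 5, 8, 1, 1]
  sink := ![2, 2, 2, 2, 4, 7]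
  start _ := 0
  prio := ![4, 5, 2, 3, 0, 1]
  prio_inj := by decide
  c_pos := by decide

/-- Agent `0`. -/
def pursuer : Fin game.n := (0 : Fin 6)

/-- Agent `1`. -/
def evader : Fin game.n := (1 : Fin 6)

theorem one_le_d (e : game.Edge) : 1 ≤ game.d e := by
  revert e
  decide

/-- The paths of the agents when Pursuer and Evader play `a` and `b` (`true` is up). -/
def route (a b : Bool) : Fin 6 → List (Fin 9 × Fin 9)
  | 0 => if a then [(0, 4), (4, 2)] else [(0, 7), (7, 2)]
  | 1 => if b then [(1, 3), (3, 4), (4, 2)] else [(1, 6), (6, 7), (7, 2)]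
  | 2 => [(5, 3), (3, 4), (4, 2)]
  | 3 => [(8, 6), (6, 7), (7, 2)]
  | 4 => [(1, 3), (3, 4)]
  | 5 => [(1, 6), (6, 7)]

theorem route_isStrat (a b : Bool) (i : Fin game.n) :
    game.IsPathFrom (game.src i) (game.sink i) (route a b i) ∧
      game.IsSimple (game.src i) (route a b i) := by
  revert a b i
  decide

def profile (a b : Bool) : game.Profile := fun i => ⟨route a b i, route_isStrat a b i⟩

theorem eq_route_of_mem_paths (i : Fin game.n) :
    ∀ p ∈ game.paths game.nV (game.src i) (game.sink i),
      p = route true true i ∨ p = route false false i := by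
  revert i
  decide +kernel

theorem strat_eq {i : Fin game.n} (s : game.Strat i) :
    s = profile true true i ∨ s = profile false false i :=
  (eq_route_of_mem_paths i s.val s.mem_paths).imp Subtype.ext Subtype.ext

theorem profile_pursuer (a b b' : Bool) :
    profile a b pursuer = profile a b' pursuer := rfl

theorem profile_evader (a a' b : Bool) :
    profile a b evader = profile a' b evader := rfl

theorem route_of_ne (a b a' b' : Bool) (i : Fin game.n) (h0 : i ≠ pursuer) (h1 : i ≠ evader) :
    route a b i = route a' b' i := by
  revert a b a' b' i
  decide

theorem degenerate (i : Fin game.n) (h0 : i ≠ pursuer) (h1 : i ≠ evader) :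
    Degenerate game i := by
  have heq : profile true true i = profile false false i :=
    Subtype.ext (route_of_ne _ _ _ _ i h0 h1)
  intro s s'
  rcases strat_eq s with rfl | rfl <;> rcases strat_eq s' with rfl | rfl <;> simp [heq]

theorem eq_profile {π : game.Profile} {a b : Bool}
    (h0 : π pursuer = profile a b pursuer)
    (h1 : π evader = profile a b evader) : π = profile a b := by
  funext i
  by_cases hi0 : i = pursuer
  · subst hi0
    exact h0
  by_cases hi1 : i = evader
  · subst hi1
    exact h1
  exact degenerate i hi0 hi1 _ _

theorem exists_eq_profile (π : game.Profile) : ∃ a b, π = profile a b := by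
  rcases strat_eq (π pursuer) with h0 | h0 <;> rcases strat_eq (π evader) with h1 | h1
  · exact ⟨true, true, eq_profile h0 h1⟩
  · exact ⟨true, false, eq_profile h0 h1⟩
  · exact ⟨false, true, eq_profile h0 h1⟩
  · exact ⟨false, false, eq_profile h0 h1⟩

/-- The times at which the agents enter the edges of their paths. -/
def enterTimes (a b : Bool) : Fin 6 → List ℕ
  | 0 => [0, if a = b then 3 else 4]
  | 1 => [0, 2, if a = b then 4 else 3]
  | 2 => if b then [0, 3, if a then 5 else 4] else [0, 2, 3]
  | 3 => if b then [0, 2, 3] else [0, 3, if a then 4 else 5]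
  | 4 => [0, 1]
  | 5 => [0, 1]

def execution (a b : Bool) : Execution (profile a b) where
  join i k := match k with
    | ⟨0, _⟩ => 0
    | ⟨k + 1, h⟩ => (enterTimes a b i).getD k 0 + game.d (edgeAt (profile a b) i ⟨k, by omega⟩)
  enter i k := (enterTimes a b i).getD k 0

theorem isFIFO_execution (a b : Bool) : IsFIFO (profile a b) (execution a b) := by
  apply IsFIFO.of_bounded
  · exact fun _ _ => rfl
  · revert a b
    decide +kernel
  · exact fun _ _ _ => rfl
  · revert a b
    decide +kernel
  · revert a b
    decide +kernel
  · revert a b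
    decide +kernel

theorem delay_pursuer (a b : Bool) :
    delay (profile a b) pursuer = if a = b then 12 else 13 := by
  rw [(isFIFO_execution a b).delay_eq one_le_d]
  revert a b
  decide +kernel

theorem delay_evader (a b : Bool) :
    delay (profile a b) evader = if a = b then 13 else 12 := by
  rw [(isFIFO_execution a b).delay_eq one_le_d]
  revert a b
  decide +kernel

theorem update_pursuer (a b a' : Bool) :
    Function.update (profile a b) pursuer (profile a' b pursuer) = profile a' b := by
  apply eq_profile
  · exact Function.update_self ..
  · rw [Function.update_of_ne (show evader ≠ pursuer by decide)]
    exact profile_evader a a' b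

theorem update_evader (a b b' : Bool) :
    Function.update (profile a b) evader (profile a b' evader) = profile a b' := by
  apply eq_profile
  · rw [Function.update_of_ne (show pursuer ≠ evader by decide)]
    exact profile_pursuer a b b'
  · exact Function.update_self ..

theorem not_isPNE (π : game.Profile) : ¬ IsPNE π := by
  obtain ⟨a, b, rfl⟩ := exists_eq_profile π
  intro h
  by_cases hab : a = b
  · have := h evader (profile a (!b) evader)
    rw [update_evader, delay_evader, delay_evader] at this
    simp [hab] at this
  · have := h pursuer (profile b b pursuer)
    rw [update_pursuer, delay_pursuer, delay_pursuer] at this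
    simp [hab] at this

end PursuerEvader

/-- There exists a FROG with two distinguished agents,
Pursuer and Evader, each having exactly two strategies (`up` and `down`), all
other agents being degenerate (unique strategy), whose total delays satisfy:
same label ⇒ `C_Pursuer = 12` and `C_Evader = 13`; different labels ⇒
`C_Pursuer = 13` and `C_Evader = 12`.  In every one of the four resulting
profiles exactly one of the two agents strictly improves by switching, so the
game has no pure Nash equilibrium. -/
theorem pursuer_evader_game :
    ∃ (Γ : FROG) (P Ev : Fin Γ.n) (upP downP : Γ.Strat P) (upE downE : Γ.Strat Ev),
      P ≠ Ev ∧ upP ≠ downP ∧ upE ≠ downE ∧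
      (∀ s : Γ.Strat P, s = upP ∨ s = downP) ∧
      (∀ s : Γ.Strat Ev, s = upE ∨ s = downE) ∧
      (∀ j : Fin Γ.n, j ≠ P → j ≠ Ev → FROG.Degenerate Γ j) ∧
      Nonempty Γ.Profile ∧
      (∀ π : Γ.Profile,
        (((π P = upP ∧ π Ev = upE) ∨ (π P = downP ∧ π Ev = downE)) →
          FROG.delay π P = 12 ∧ FROG.delay π Ev = 13) ∧
        (((π P = upP ∧ π Ev = downE) ∨ (π P = downP ∧ π Ev = upE)) →
          FROG.delay π P = 13 ∧ FROG.delay π Ev = 12)) ∧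
      (∀ π : Γ.Profile, ¬ FROG.IsPNE π) := by
  refine ⟨PursuerEvader.game, PursuerEvader.pursuer, PursuerEvader.evader,
    PursuerEvader.profile true true PursuerEvader.pursuer,
    PursuerEvader.profile false false PursuerEvader.pursuer,
    PursuerEvader.profile true true PursuerEvader.evader,
    PursuerEvader.profile false false PursuerEvader.evader,
    by decide, fun h => absurd (congrArg Subtype.val h) (by decide),
    fun h => absurd (congrArg Subtype.val h) (by decide),
    PursuerEvader.strat_eq, PursuerEvader.strat_eq, PursuerEvader.degenerate,
    ⟨PursuerEvader.profile true true⟩, fun π => ⟨?_, ?_⟩, PursuerEvader.not_isPNE⟩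
  · rintro (⟨h0, h1⟩ | ⟨h0, h1⟩)
    · rw [PursuerEvader.eq_profile (a := true) (b := true) h0 h1]
      exact ⟨PursuerEvader.delay_pursuer _ _, PursuerEvader.delay_evader _ _⟩
    · rw [PursuerEvader.eq_profile (a := false) (b := false) h0 h1]
      exact ⟨PursuerEvader.delay_pursuer _ _, PursuerEvader.delay_evader _ _⟩
  · rintro (⟨h0, h1⟩ | ⟨h0, h1⟩)
    · rw [PursuerEvader.eq_profile (a := true) (b := false) h0 h1]
      exact ⟨PursuerEvader.delay_pursuer _ _, PursuerEvader.delay_evader _ _⟩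
    · rw [PursuerEvader.eq_profile (a := false) (b := true) h0 h1]
      exact ⟨PursuerEvader.delay_pursuer _ _, PursuerEvader.delay_evader _ _⟩
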